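/- Let q ∈ ℂ ∖ ℝ. For an ℝ-algebra automorphism f of ℝ[x,y,z] with f(z) = z, let Ψ_q(f) be the ℂ-algebra endomorphism of ℂ[x,y] sending x and y respectively to the images of f(x) and f(y) under the ring homomorphism ℝ[x,y,z] → ℂ[x,y] given by x ↦ x, y ↦ y, z ↦ q. Then Ψ_q(f) is a ℂ-algebra automorphism of ℂ[x,y], the map Ψ_q from {f ∈ Aut_ℝ(ℝ[x,y,z]) : f(z) = z} to Aut_ℂ(ℂ[x,y]) is a group homomorphism, and its image consists exactly of those ℂ-algebra automorphisms φ of ℂ[x,y] whose Jacobian determinant ∂φ(x)/∂x · ∂φ(y)/∂y − ∂φ(x)/∂y · ∂φ(y)/∂x (a nonzero constant) lies in ℝ. -/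

import Mathlib

open MvPolynomial

/-- Evaluation `ℝ[x,y,z] → ℂ[x,y]` sending `x ↦ x`, `y ↦ y`, `z ↦ q`. -/
noncomputable def evq (q : ℂ) : MvPolynomial (Fin 3) ℝ →ₐ[ℝ] MvPolynomial (Fin 2) ℂ :=
  aeval ![X 0, X 1, MvPolynomial.C q]

/-- `Ψ_q(f)`: the `ℂ`-algebra endomorphism of `ℂ[x,y]` sending `x` and `y` to the
specializations at `z = q` of `f(x)` and `f(y)`. -/
noncomputable def Psi (q : ℂ) (f : MvPolynomial (Fin 3) ℝ →ₐ[ℝ] MvPolynomial (Fin 3) ℝ) :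
    MvPolynomial (Fin 2) ℂ →ₐ[ℂ] MvPolynomial (Fin 2) ℂ :=
  aeval ![evq q (f (X 0)), evq q (f (X 1))]

/-- The Jacobian determinant of an endomorphism of `ℂ[x,y]`. -/
noncomputable def Jac (φ : MvPolynomial (Fin 2) ℂ →ₐ[ℂ] MvPolynomial (Fin 2) ℂ) :
    MvPolynomial (Fin 2) ℂ :=
  pderiv 0 (φ (X 0)) * pderiv 1 (φ (X 1)) - pderiv 1 (φ (X 0)) * pderiv 0 (φ (X 1))

section LND
variable {A : Type*} [CommRing A] [IsDomain A] [CharZero A]  [Algebra ℂ A]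

theorem lnd_mul_iter (D : Derivation ℂ A A) : ∀ (N i j : ℕ) (f g : A), i + j = N →
    D^[i+1] f = 0 → D^[j+1] g = 0 →
    D^[N] (f * g) = (N.choose i : A) * (D^[i] f * D^[j] g) := by
  intro N
  induction N with
  | zero =>
    intro i j f g h hf hg
    obtain ⟨rfl, rfl⟩ : i = 0 ∧ j = 0 := by omega
    simp
  | succ N ih =>
    intro i j f g h hf hg
    have hz : ∀ k, D^[k] (0:A) = 0 := fun k => iterate_map_zero D k
    rw [Function.iterate_succ_apply, D.leibniz, iterate_map_add, smul_eq_mul, smul_eq_mul]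
    rcases i with _ | i
    · obtain rfl : j = N + 1 := by omega
      have : D f = 0 := hf
      rw [this, mul_zero, hz, add_zero, ih 0 N f (D g) (by omega) hf hg]
      simp
    · rcases j with _ | j
      · obtain rfl : i = N := by omega
        have : D g = 0 := hg
        rw [this, mul_zero, hz, zero_add, mul_comm g, ih i 0 (D f) g (by omega) hf hg]
        simp
      · rw [ih (i+1) j f (D g) (by omega) hf hg, mul_comm g,
          ih i (j+1) (D f) g (by omega) hf hg, Nat.choose_succ_succ]
        simp only [← Function.iterate_succ_apply]
        push_cast
        ring

theorem lnd_mul_iter_succ (D : Derivation ℂ A A) (i j : ℕ) (f g : A)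
    (hf : D^[i+1] f = 0) (hg : D^[j+1] g = 0) : D^[i+j+1] (f * g) = 0 := by
  rw [Function.iterate_succ_apply', lnd_mul_iter D (i+j) i j f g rfl hf hg, D.leibniz, D.leibniz,
    ← Function.iterate_succ_apply' D, ← Function.iterate_succ_apply' D, hf, hg]
  simp

/-- locally nilpotent -/
def IsLND (D : Derivation ℂ A A) : Prop := ∀ f, ∃ k, D^[k] f = 0

theorem iter_zero_mono (D : Derivation ℂ A A) {f : A} {k l : ℕ} (h : D^[k] f = 0) (hkl : k ≤ l) :
    D^[l] f = 0 := by
  obtain ⟨c, rfl⟩ := Nat.exists_eq_add_of_le hkl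
  rw [add_comm, Function.iterate_add_apply, h, iterate_map_zero D c]

def NN (D : Derivation ℂ A A) (k : ℕ) (f : A) : Prop := D^[k] f ≠ 0 ∧ D^[k+1] f = 0

theorem NN_mul {D : Derivation ℂ A A} {i j : ℕ} {f g : A} (hf : NN D i f) (hg : NN D j g) :
    NN D (i+j) (f*g) := by
  refine ⟨?_, lnd_mul_iter_succ D i j f g hf.2 hg.2⟩
  rw [lnd_mul_iter D _ i j f g rfl hf.2 hg.2]
  refine mul_ne_zero ?_ (mul_ne_zero hf.1 hg.1)
  have := Nat.choose_pos (Nat.le_add_right i j)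
  exact_mod_cast this.ne'

theorem NN_unique {D : Derivation ℂ A A} {i j : ℕ} {f : A} (hf : NN D i f) (hg : NN D j f) :
    i = j := by
  by_contra hne
  rcases lt_or_gt_of_ne hne with h | h
  · exact hg.1 (iter_zero_mono D hf.2 h)
  · exact hf.1 (iter_zero_mono D hg.2 h)

theorem NN_exists {D : Derivation ℂ A A} (hD : IsLND D) {f : A} (hf : f ≠ 0) : ∃ k, NN D k f := by
  classical
  have h := hD f
  have h0 : Nat.find h ≠ 0 := by
    intro h0
    have := Nat.find_spec h
    rw [h0] at this
    exact hf this
  obtain ⟨k, hk⟩ := Nat.exists_eq_succ_of_ne_zero h0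
  refine ⟨k, Nat.find_min h (by omega), ?_⟩
  have := Nat.find_spec h
  rwa [hk] at this

theorem lnd_ker_factor {D : Derivation ℂ A A} (hD : IsLND D) {f g : A} (h : D (f * g) = 0)
    (hfg : f * g ≠ 0) : D f = 0 := by
  obtain ⟨i, hi⟩ := NN_exists hD (left_ne_zero_of_mul hfg)
  obtain ⟨j, hj⟩ := NN_exists hD (right_ne_zero_of_mul hfg)
  have h0 : NN D 0 (f * g) := ⟨hfg, h⟩
  have := NN_unique (NN_mul hi hj) h0
  obtain rfl : i = 0 := by omega
  exact hi.2

theorem lnd_ker_dvd {D : Derivation ℂ A A} (hD : IsLND D) {f g : A} (h : D g = 0)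
    (hg : g ≠ 0) (hfg : f ∣ g) : D f = 0 := by
  obtain ⟨c, rfl⟩ := hfg
  exact lnd_ker_factor hD h hg

theorem NN_D_dvd {D : Derivation ℂ A A} (hD : IsLND D) {f g : A} {i j : ℕ}
    (hi : NN D i f) (hj : NN D j g) (h0 : D f ≠ 0) (h : g ∣ D f) : j < i := by
  rcases i with _ | i
  · exact absurd hi.2 h0
  have h1 : NN D i (D f) := hi
  obtain ⟨c, hc⟩ := h
  rw [hc] at h1 h0
  obtain ⟨k, hk⟩ := NN_exists hD (right_ne_zero_of_mul h0)
  have := NN_unique (NN_mul hj hk) h1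
  omega

theorem lnd_cross {D : Derivation ℂ A A} (hD : IsLND D) {f g : A} (hf : f ≠ 0) (hg : g ≠ 0)
    (h1 : g ∣ D f) (h2 : f ∣ D g) : D f = 0 ∨ D g = 0 := by
  by_contra! hh
  obtain ⟨i, hi⟩ := NN_exists hD hf
  obtain ⟨j, hj⟩ := NN_exists hD hg
  have := NN_D_dvd hD hi hj hh.1 h1
  have := NN_D_dvd hD hj hi hh.2 h2
  omega

theorem isLND_of_gen {D : Derivation ℂ A A} (φ : MvPolynomial (Fin 2) ℂ →ₐ[ℂ] A)
    (hφ : Function.Surjective φ) (h : ∀ i, ∃ k, D^[k] (φ (X i)) = 0) : IsLND D := by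
  intro f
  obtain ⟨p, rfl⟩ := hφ f
  induction p using MvPolynomial.induction_on with
  | C a =>
    refine ⟨1, ?_⟩
    have : φ (MvPolynomial.C a) = algebraMap ℂ A a := φ.commutes a
    simp [this]
  | add p q hp hq =>
    obtain ⟨k, hk⟩ := hp
    obtain ⟨l, hl⟩ := hq
    refine ⟨k + l, ?_⟩
    rw [map_add, iterate_map_add, iter_zero_mono D hk (by omega), iter_zero_mono D hl (by omega),
      add_zero]
  | mul_X p i hp =>
    obtain ⟨k, hk⟩ := hp
    obtain ⟨l, hl⟩ := h i
    refine ⟨k + l + 1, ?_⟩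
    rw [map_mul]
    exact lnd_mul_iter_succ D k l _ _ (iter_zero_mono D hk (by omega))
      (iter_zero_mono D hl (by omega))

end LND

/-- Jacobian derivation. -/
noncomputable def jd (F : MvPolynomial (Fin 2) ℂ) :
    Derivation ℂ (MvPolynomial (Fin 2) ℂ) (MvPolynomial (Fin 2) ℂ) :=
  (pderiv 0 F) • pderiv 1 - (pderiv 1 F) • pderiv 0

theorem jd_apply (F G : MvPolynomial (Fin 2) ℂ) :
    jd F G = pderiv 0 F * pderiv 1 G - pderiv 1 F * pderiv 0 G := by
  simp [jd]

theorem Jac_eq (φ : MvPolynomial (Fin 2) ℂ →ₐ[ℂ] MvPolynomial (Fin 2) ℂ) :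
    Jac φ = jd (φ (X 0)) (φ (X 1)) := by rw [jd_apply, Jac]

theorem chain2 (d : Derivation ℂ (MvPolynomial (Fin 2) ℂ) (MvPolynomial (Fin 2) ℂ))
    (φ : MvPolynomial (Fin 2) ℂ →ₐ[ℂ] MvPolynomial (Fin 2) ℂ) (a : MvPolynomial (Fin 2) ℂ) :
    d (φ a) = φ (pderiv 0 a) * d (φ (X 0)) + φ (pderiv 1 a) * d (φ (X 1)) := by
  induction a using MvPolynomial.induction_on with
  | C a =>
    have : φ (MvPolynomial.C a) = algebraMap ℂ _ a := φ.commutes a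
    rw [this]; simp
  | add p q hp hq => simp only [map_add, hp, hq]; ring
  | mul_X p i hp =>
    simp only [map_mul, Derivation.leibniz, smul_eq_mul, map_add, hp]
    fin_cases i <;> simp [pderiv_X] <;> ring

theorem chain3 {R : Type*} [CommRing R] [Algebra ℝ R] (d : Derivation ℝ R R)
    (φ : MvPolynomial (Fin 3) ℝ →ₐ[ℝ] R) (a : MvPolynomial (Fin 3) ℝ) :
    d (φ a) = φ (pderiv 0 a) * d (φ (X 0)) + φ (pderiv 1 a) * d (φ (X 1))
      + φ (pderiv 2 a) * d (φ (X 2)) := by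
  induction a using MvPolynomial.induction_on with
  | C a =>
    have : φ (MvPolynomial.C a) = algebraMap ℝ _ a := φ.commutes a
    rw [this]; simp
  | add p q hp hq => simp only [map_add, hp, hq]; ring
  | mul_X p i hp =>
    simp only [map_mul, Derivation.leibniz, smul_eq_mul, map_add, hp]
    fin_cases i <;> simp [pderiv_X] <;> ring

theorem jd_comp (φ : MvPolynomial (Fin 2) ℂ →ₐ[ℂ] MvPolynomial (Fin 2) ℂ)
    (a b : MvPolynomial (Fin 2) ℂ) : jd (φ a) (φ b) = φ (jd a b) * Jac φ := by
  simp only [Jac, jd_apply, chain2 (pderiv _) φ a, chain2 (pderiv _) φ b, map_sub, map_mul]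
  ring

theorem Jac_comp (τ φ : MvPolynomial (Fin 2) ℂ →ₐ[ℂ] MvPolynomial (Fin 2) ℂ) :
    Jac (τ.comp φ) = τ (Jac φ) * Jac τ := by
  rw [Jac_eq, Jac_eq φ]; exact jd_comp τ _ _

theorem Jac_isUnit (φ : MvPolynomial (Fin 2) ℂ →ₐ[ℂ] MvPolynomial (Fin 2) ℂ)
    (h : Function.Surjective φ) : IsUnit (Jac φ) := by
  obtain ⟨a, ha⟩ := h (X 0)
  obtain ⟨b, hb⟩ := h (X 1)
  have h1 := jd_comp φ a b
  rw [ha, hb, jd_apply] at h1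
  simp [pderiv_X] at h1
  exact IsUnit.of_mul_eq_one_right _ h1.symm

theorem jd_self (F : MvPolynomial (Fin 2) ℂ) : jd F F = 0 := by rw [jd_apply]; ring

theorem jd_isLND (φ : MvPolynomial (Fin 2) ℂ →ₐ[ℂ] MvPolynomial (Fin 2) ℂ)
    (h : Function.Surjective φ) (r : ℂ) (hr : Jac φ = MvPolynomial.C r) :
    IsLND (jd (φ (X 0))) := by
  refine isLND_of_gen φ h ?_
  intro i
  fin_cases i
  · exact ⟨1, jd_self _⟩
  · refine ⟨2, ?_⟩
    rw [Jac_eq] at hr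
    simp [hr]

/-- weight -/
def wt (u v : ℤ) (s : Fin 2 →₀ ℕ) : ℤ := u * s 0 + v * s 1

def TopP (u v : ℤ) (h : MvPolynomial (Fin 2) ℂ) (e : ℤ) (g : MvPolynomial (Fin 2) ℂ) : Prop :=
  ∀ s, (e < wt u v s → coeff s h = 0) ∧ (wt u v s = e → coeff s g = coeff s h) ∧
    (wt u v s ≠ e → coeff s g = 0)

theorem wt_add (u v : ℤ) (s t : Fin 2 →₀ ℕ) : wt u v (s + t) = wt u v s + wt u v t := by
  simp [wt]; ring

theorem TopP.mul {u v e e' : ℤ} {h g h' g' : MvPolynomial (Fin 2) ℂ}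
    (H : TopP u v h e g) (H' : TopP u v h' e' g') : TopP u v (h * h') (e + e') (g * g') := by
  intro s
  simp only [coeff_mul]
  refine ⟨fun hs => ?_, fun hs => ?_, fun hs => ?_⟩
  · refine Finset.sum_eq_zero ?_
    rintro ⟨a, b⟩ hab
    have hab : a + b = s := by simpa using hab
    have hw := wt_add u v a b
    rw [hab] at hw
    by_cases h1 : e < wt u v a
    · simp [(H a).1 h1]
    · have h2 : e' < wt u v b := by omega
      simp [(H' b).1 h2]
  · refine Finset.sum_congr rfl ?_
    rintro ⟨a, b⟩ hab
    have hab : a + b = s := by simpa using hab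
    have hw := wt_add u v a b
    rw [hab] at hw
    rcases lt_trichotomy e (wt u v a) with h1 | h1 | h1
    · simp [(H a).1 h1, (H a).2.2 h1.ne']
    · simp [(H a).2.1 h1.symm, (H' b).2.1 (by omega)]
    · have h2 : e' < wt u v b := by omega
      simp [(H' b).1 h2, (H' b).2.2 h2.ne']
  · refine Finset.sum_eq_zero ?_
    rintro ⟨a, b⟩ hab
    have hab : a + b = s := by simpa using hab
    have hw := wt_add u v a b
    rw [hab] at hw
    by_cases h1 : wt u v a = e
    · have h2 : wt u v b ≠ e' := by omega
      simp [(H' b).2.2 h2]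
    · simp [(H a).2.2 h1]

theorem TopP.sub {u v e : ℤ} {h g h' g' : MvPolynomial (Fin 2) ℂ}
    (H : TopP u v h e g) (H' : TopP u v h' e g') : TopP u v (h - h') e (g - g') := by
  intro s
  simp only [coeff_sub]
  refine ⟨fun hs => ?_, fun hs => ?_, fun hs => ?_⟩
  · simp [(H s).1 hs, (H' s).1 hs]
  · simp [(H s).2.1 hs, (H' s).2.1 hs]
  · simp [(H s).2.2 hs, (H' s).2.2 hs]

theorem coeff_pd (i : Fin 2) (s : Fin 2 →₀ ℕ) (h : MvPolynomial (Fin 2) ℂ) :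
    coeff s (pderiv i h) = coeff (s + Finsupp.single i 1) h * (s i + 1) := by
  induction h using MvPolynomial.induction_on' with
  | add p q hp hq => simp only [map_add, coeff_add, hp, hq]; ring
  | monomial t a =>
    rw [pderiv_monomial, coeff_monomial, coeff_monomial]
    by_cases h1 : t = s + Finsupp.single i 1
    · subst h1; simp
    · rw [if_neg h1, zero_mul]
      split_ifs with h2
      · have : t i = 0 := by
          by_contra h3
          apply h1
          rw [← h2]
          ext j
          by_cases hj : j = i
          · subst hj; simp; omega
          · simp [Finsupp.single_apply, Ne.symm hj]
        simp [this]
      · rfl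

theorem wt_single0 (u v : ℤ) (k : ℕ) : wt u v (Finsupp.single 0 k) = u * k := by simp [wt]
theorem wt_single1 (u v : ℤ) (k : ℕ) : wt u v (Finsupp.single 1 k) = v * k := by simp [wt]

theorem TopP.pd {u v e : ℤ} {h g : MvPolynomial (Fin 2) ℂ}
    (H : TopP u v h e g) (i : Fin 2) :
    TopP u v (pderiv i h) (e - wt u v (Finsupp.single i 1)) (pderiv i g) := by
  intro s
  have hw := wt_add u v s (Finsupp.single i 1)
  simp only [coeff_pd]
  refine ⟨fun hs => ?_, fun hs => ?_, fun hs => ?_⟩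
  · rw [(H _).1 (by omega), zero_mul]
  · rw [(H _).2.1 (by omega)]
  · rw [(H _).2.2 (by omega), zero_mul]

theorem TopP.jd {u v e d : ℤ} {F F' h g : MvPolynomial (Fin 2) ℂ}
    (HF : TopP u v F d F') (H : TopP u v h e g) :
    TopP u v (jd F h) (e + (d - u - v)) (jd F' g) := by
  rw [jd_apply, jd_apply]
  refine TopP.sub ?_ ?_
  · have := (HF.pd 0).mul (H.pd 1)
    rw [wt_single0, wt_single1] at this
    convert this using 1
    push_cast; ring
  · have := (HF.pd 1).mul (H.pd 0)
    rw [wt_single0, wt_single1] at this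
    convert this using 1
    push_cast; ring

theorem TopP.iter {u v e d : ℤ} {F F' h g : MvPolynomial (Fin 2) ℂ}
    (HF : TopP u v F d F') (H : TopP u v h e g) (k : ℕ) :
    TopP u v ((_root_.jd F)^[k] h) (e + k * (d - u - v)) ((_root_.jd F')^[k] g) := by
  induction k with
  | zero => simpa using H
  | succ k ih =>
    rw [Function.iterate_succ_apply', Function.iterate_succ_apply']
    convert HF.jd ih using 1
    push_cast; ring

theorem TopP.zero {u v e : ℤ} {g : MvPolynomial (Fin 2) ℂ} (H : TopP u v 0 e g) : g = 0 := by
  ext s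
  by_cases hs : wt u v s = e
  · rw [(H s).2.1 hs]
  · rw [(H s).2.2 hs]; simp

theorem TopP.X (u v : ℤ) (i : Fin 2) :
    TopP u v (MvPolynomial.X i) (wt u v (Finsupp.single i 1)) (MvPolynomial.X i) := by
  intro s
  have : ∀ s : Fin 2 →₀ ℕ, wt u v s ≠ wt u v (Finsupp.single i 1) →
      coeff s (MvPolynomial.X i : MvPolynomial (Fin 2) ℂ) = 0 := by
    intro s hs
    rw [coeff_X', if_neg]
    rintro rfl
    exact hs rfl
  exact ⟨fun hs => this s hs.ne', fun _ => rfl, fun hs => this s hs⟩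

theorem TopP.isLND {u v d : ℤ} {F F' : MvPolynomial (Fin 2) ℂ}
    (HF : TopP u v F d F') (h : IsLND (_root_.jd F)) : IsLND (_root_.jd F') := by
  refine isLND_of_gen (AlgHom.id ℂ _) Function.surjective_id ?_
  intro i
  obtain ⟨k, hk⟩ := h (MvPolynomial.X i)
  refine ⟨k, ?_⟩
  have := HF.iter (TopP.X u v i) k
  rw [hk] at this
  exact this.zero

noncomputable def topPart (u v d : ℤ) (F : MvPolynomial (Fin 2) ℂ) : MvPolynomial (Fin 2) ℂ :=
  ∑ s ∈ F.support with wt u v s = d, monomial s (coeff s F)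

theorem coeff_topPart (u v d : ℤ) (F : MvPolynomial (Fin 2) ℂ) (s : Fin 2 →₀ ℕ) :
    coeff s (topPart u v d F) = if wt u v s = d then coeff s F else 0 := by
  classical
  rw [topPart, coeff_sum]
  simp only [coeff_monomial]
  rw [Finset.sum_ite_eq']
  by_cases h : wt u v s = d <;> by_cases h2 : coeff s F = 0 <;> simp [h, h2]

theorem topPart_Top (u v d : ℤ) (F : MvPolynomial (Fin 2) ℂ)
    (h : ∀ s, coeff s F ≠ 0 → wt u v s ≤ d) : TopP u v F d (topPart u v d F) := by
  intro s
  refine ⟨fun hs => ?_, fun hs => ?_, fun hs => ?_⟩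
  · by_contra h2
    have := h s h2
    omega
  · rw [coeff_topPart, if_pos hs]
  · rw [coeff_topPart, if_neg hs]

theorem evq_f (q : ℂ) (f : MvPolynomial (Fin 3) ℝ →ₐ[ℝ] MvPolynomial (Fin 3) ℝ)
    (hf : f (X 2) = X 2) (p : MvPolynomial (Fin 3) ℝ) :
    evq q (f p) = Psi q f (evq q p) := by
  have : (evq q).comp f = ((Psi q f).restrictScalars ℝ).comp (evq q) := by
    ext i
    fin_cases i
    · simp [evq, Psi]
    · simp [evq, Psi]
    · simp only [AlgHom.comp_apply, AlgHom.restrictScalars_apply]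
      have h : ((⟨2, by omega⟩ : Fin 3)) = 2 := rfl
      simp only [h, hf]
      have : evq q (X 2) = algebraMap ℂ _ q := by simp [evq, MvPolynomial.algebraMap_eq]
      rw [this, AlgHom.commutes]
  exact DFunLike.congr_fun this p

theorem Psi_comp (q : ℂ) (f g : MvPolynomial (Fin 3) ℝ →ₐ[ℝ] MvPolynomial (Fin 3) ℝ)
    (hf : f (X 2) = X 2) : Psi q (f.comp g) = (Psi q f).comp (Psi q g) := by
  apply MvPolynomial.algHom_ext
  intro i
  fin_cases i
  · simp only [AlgHom.comp_apply]
    simp [Psi, ← evq_f q f hf]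
    rw [evq_f q f hf]; rfl
  · simp only [AlgHom.comp_apply]
    simp [Psi, ← evq_f q f hf]
    rw [evq_f q f hf]; rfl

theorem Psi_id (q : ℂ) :
    Psi q (AlgHom.id ℝ (MvPolynomial (Fin 3) ℝ)) = AlgHom.id ℂ (MvPolynomial (Fin 2) ℂ) := by
  apply MvPolynomial.algHom_ext
  intro i
  fin_cases i <;> simp [Psi, evq]

theorem Psi_bij (q : ℂ) (f : MvPolynomial (Fin 3) ℝ ≃ₐ[ℝ] MvPolynomial (Fin 3) ℝ)
    (hf : f (X 2) = X 2) : Function.Bijective (Psi q f.toAlgHom) := by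
  have hs : f.symm (X 2) = X 2 := (AlgEquiv.symm_apply_eq f).2 hf.symm
  have h1 := Psi_comp q f.toAlgHom f.symm.toAlgHom hf
  have h2 := Psi_comp q f.symm.toAlgHom f.toAlgHom hs
  have e1 : f.toAlgHom.comp f.symm.toAlgHom = AlgHom.id ℝ _ := by ext; simp
  have e2 : f.symm.toAlgHom.comp f.toAlgHom = AlgHom.id ℝ _ := by ext; simp
  rw [e1, Psi_id] at h1
  rw [e2, Psi_id] at h2
  refine Function.bijective_iff_has_inverse.2 ⟨Psi q f.symm.toAlgHom, fun p => ?_, fun p => ?_⟩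
  · exact (DFunLike.congr_fun h2 p).symm
  · exact (DFunLike.congr_fun h1 p).symm

/-- partial Jacobian -/
noncomputable def J3 (a b : MvPolynomial (Fin 3) ℝ) : MvPolynomial (Fin 3) ℝ :=
  pderiv 0 a * pderiv 1 b - pderiv 1 a * pderiv 0 b

theorem J3_comp (f : MvPolynomial (Fin 3) ℝ →ₐ[ℝ] MvPolynomial (Fin 3) ℝ)
    (hf : f (X 2) = X 2) (a b : MvPolynomial (Fin 3) ℝ) :
    J3 (f a) (f b) = f (J3 a b) * J3 (f (X 0)) (f (X 1)) := by
  simp only [J3, chain3 (pderiv _) f a, chain3 (pderiv _) f b, hf, map_sub, map_mul,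
    pderiv_X]
  simp
  ring

theorem pderiv_evq (q : ℂ) (p : MvPolynomial (Fin 3) ℝ) :
    pderiv 0 (evq q p) = evq q (pderiv 0 p) ∧ pderiv 1 (evq q p) = evq q (pderiv 1 p) := by
  have hx : evq q (X 0) = X 0 := by simp [evq]
  have hy : evq q (X 1) = X 1 := by simp [evq]
  have hz : evq q (X 2) = C q := by simp [evq]
  constructor
  · have := chain3 ((pderiv (R := ℂ) (0 : Fin 2)).restrictScalars ℝ) (evq q) p
    simp only [Derivation.restrictScalars_apply, hx, hy, hz] at this
    simpa [pderiv_X] using this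
  · have := chain3 ((pderiv (R := ℂ) (1 : Fin 2)).restrictScalars ℝ) (evq q) p
    simp only [Derivation.restrictScalars_apply, hx, hy, hz] at this
    simpa [pderiv_X] using this

theorem Psi_jac (q : ℂ) (f : MvPolynomial (Fin 3) ℝ ≃ₐ[ℝ] MvPolynomial (Fin 3) ℝ)
    (hf : f (X 2) = X 2) : ∃ r : ℝ, Jac (Psi q f.toAlgHom) = MvPolynomial.C (r : ℂ) := by
  obtain ⟨a, ha⟩ := f.surjective (X 0)
  obtain ⟨b, hb⟩ := f.surjective (X 1)
  have h := J3_comp f.toAlgHom hf a b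
  have ha' : f.toAlgHom a = X 0 := ha
  have hb' : f.toAlgHom b = X 1 := hb
  rw [ha', hb'] at h
  have h1 : J3 (X 0) (X 1) = 1 := by simp [J3, pderiv_X]
  rw [h1] at h
  have hu := IsUnit.of_mul_eq_one_right _ h.symm
  rw [MvPolynomial.isUnit_iff_eq_C_of_isReduced] at hu
  obtain ⟨r, -, hr⟩ := hu
  refine ⟨r, ?_⟩
  have : Jac (Psi q f.toAlgHom) = evq q (J3 (f.toAlgHom (X 0)) (f.toAlgHom (X 1))) := by
    simp only [Jac, J3, map_sub, map_mul, ← (pderiv_evq q _).1, ← (pderiv_evq q _).2]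
    simp [Psi]
  rw [this, hr, ← MvPolynomial.algebraMap_eq, AlgHom.commutes, MvPolynomial.algebraMap_apply]
  rfl

def Lift (q : ℂ) (φ : MvPolynomial (Fin 2) ℂ →ₐ[ℂ] MvPolynomial (Fin 2) ℂ) : Prop :=
  ∃ f : MvPolynomial (Fin 3) ℝ ≃ₐ[ℝ] MvPolynomial (Fin 3) ℝ,
          f (X 2) = X 2 ∧ Psi q f.toAlgHom = φ

theorem Lift.comp {q : ℂ} {φ ψ : MvPolynomial (Fin 2) ℂ →ₐ[ℂ] MvPolynomial (Fin 2) ℂ}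
    (h1 : Lift q φ) (h2 : Lift q ψ) : Lift q (φ.comp ψ) := by
  obtain ⟨f, hf, rfl⟩ := h1
  obtain ⟨g, hg, rfl⟩ := h2
  refine ⟨g.trans f, by simp [hf, hg], ?_⟩
  rw [← Psi_comp q _ _ hf]
  rfl

noncomputable def sh0 (p : Polynomial ℂ) : MvPolynomial (Fin 2) ℂ →ₐ[ℂ] MvPolynomial (Fin 2) ℂ :=
  aeval ![X 0 + Polynomial.aeval (X 1) p, X 1]

noncomputable def sh1 (p : Polynomial ℂ) : MvPolynomial (Fin 2) ℂ →ₐ[ℂ] MvPolynomial (Fin 2) ℂ :=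
  aeval ![X 0, X 1 + Polynomial.aeval (X 0) p]

noncomputable def sw : MvPolynomial (Fin 2) ℂ →ₐ[ℂ] MvPolynomial (Fin 2) ℂ :=
  aeval ![X 1, X 0]

noncomputable def dg (a b : ℂ) : MvPolynomial (Fin 2) ℂ →ₐ[ℂ] MvPolynomial (Fin 2) ℂ :=
  aeval ![C a * X 0, C b * X 1]

theorem hom_ext2 {A : Type*} [CommRing A] [Algebra ℂ A] {φ ψ : MvPolynomial (Fin 2) ℂ →ₐ[ℂ] A}
    (h0 : φ (X 0) = ψ (X 0)) (h1 : φ (X 1) = ψ (X 1)) : φ = ψ := by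
  apply MvPolynomial.algHom_ext
  intro i
  fin_cases i
  · exact h0
  · exact h1

theorem hom_aeval {A : Type*} [CommRing A] [Algebra ℂ A] (φ : MvPolynomial (Fin 2) ℂ →ₐ[ℂ] A)
    (p : Polynomial ℂ) (x : MvPolynomial (Fin 2) ℂ) :
    φ (Polynomial.aeval x p) = Polynomial.aeval (φ x) p := (Polynomial.aeval_algHom_apply φ x p).symm

@[simp] theorem sh0_X0 (p : Polynomial ℂ) : sh0 p (X 0) = X 0 + Polynomial.aeval (X 1) p := by
  simp [sh0]
@[simp] theorem sh0_X1 (p : Polynomial ℂ) : sh0 p (X 1) = X 1 := by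
  simp [sh0]
@[simp] theorem sh1_X0 (p : Polynomial ℂ) : sh1 p (X 0) = X 0 := by
  simp [sh1]
@[simp] theorem sh1_X1 (p : Polynomial ℂ) : sh1 p (X 1) = X 1 + Polynomial.aeval (X 0) p := by
  simp [sh1]
@[simp] theorem sw_X0 : sw (X 0) = X 1 := by simp [sw]
@[simp] theorem sw_X1 : sw (X 1) = X 0 := by simp [sw]
@[simp] theorem dg_X0 (a b : ℂ) : dg a b (X 0) = C a * X 0 := by simp [dg]
@[simp] theorem dg_X1 (a b : ℂ) : dg a b (X 1) = C b * X 1 := by simp [dg]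
theorem hom_C (φ : MvPolynomial (Fin 2) ℂ →ₐ[ℂ] MvPolynomial (Fin 2) ℂ) (a : ℂ) :
    φ (C a) = C a := φ.commutes a

theorem sw_sw : sw.comp sw = AlgHom.id ℂ _ := hom_ext2 (by simp) (by simp)

theorem sh0_add (p p' : Polynomial ℂ) : sh0 (p + p') = (sh0 p).comp (sh0 p') := by
  apply hom_ext2
  · simp [hom_aeval]; ring
  · simp

theorem sh0_neg (p : Polynomial ℂ) : (sh0 (-p)).comp (sh0 p) = AlgHom.id ℂ _ := by
  rw [← sh0_add]
  apply hom_ext2 <;> simp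

theorem sh0_neg' (p : Polynomial ℂ) : (sh0 p).comp (sh0 (-p)) = AlgHom.id ℂ _ := by
  rw [← sh0_add]
  apply hom_ext2 <;> simp

theorem sh1_eq (p : Polynomial ℂ) : sh1 p = (sw.comp (sh0 p)).comp sw := by
  apply hom_ext2
  · simp
  · simp [hom_aeval]

theorem fin3_ext {φ ψ : MvPolynomial (Fin 3) ℝ →ₐ[ℝ] MvPolynomial (Fin 3) ℝ}
    (h0 : φ (X 0) = ψ (X 0)) (h1 : φ (X 1) = ψ (X 1)) (h2 : φ (X 2) = ψ (X 2)) : φ = ψ := by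
  apply MvPolynomial.algHom_ext
  intro i
  fin_cases i
  · exact h0
  · exact h1
  · exact h2

theorem lift_of (q : ℂ) (φ : MvPolynomial (Fin 2) ℂ →ₐ[ℂ] MvPolynomial (Fin 2) ℂ)
    (f g : MvPolynomial (Fin 3) ℝ →ₐ[ℝ] MvPolynomial (Fin 3) ℝ)
    (hf : f (X 2) = X 2) (hg : g (X 2) = X 2)
    (h0 : f (g (X 0)) = X 0) (h1 : f (g (X 1)) = X 1)
    (h0' : g (f (X 0)) = X 0) (h1' : g (f (X 1)) = X 1)
    (e0 : evq q (f (X 0)) = φ (X 0)) (e1 : evq q (f (X 1)) = φ (X 1)) : Lift q φ := by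
  refine ⟨AlgEquiv.ofAlgHom f g (fin3_ext (by simpa using h0) (by simpa using h1) (by simp [hf, hg]))
    (fin3_ext (by simpa using h0') (by simpa using h1') (by simp [hf, hg])), by simp [hf], ?_⟩
  apply hom_ext2
  · simp [Psi, e0]
  · simp [Psi, e1]

theorem lift_sw (q : ℂ) : Lift q sw := by
  refine lift_of q sw (aeval ![X 1, X 0, X 2]) (aeval ![X 1, X 0, X 2]) ?_ ?_ ?_ ?_ ?_ ?_ ?_ ?_ <;>
    simp [evq]

theorem lift_dg1 (q : ℂ) (r : ℝ) (hr : r ≠ 0) : Lift q (dg 1 r) := by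
  have h : (C r * C r⁻¹ : MvPolynomial (Fin 3) ℝ) = 1 := by rw [← C_mul, mul_inv_cancel₀ hr, C_1]
  refine lift_of q _ (aeval ![X 0, C r * X 1, X 2]) (aeval ![X 0, C r⁻¹ * X 1, X 2])
    ?_ ?_ ?_ ?_ ?_ ?_ ?_ ?_
  · simp
  · simp
  · simp
  · simp only [map_mul, aeval_X, aeval_C, MvPolynomial.algebraMap_eq]
    simp
    linear_combination (X 1) * h
  · simp
  · simp only [map_mul, aeval_X, aeval_C, MvPolynomial.algebraMap_eq]
    simp
    linear_combination (X 1) * h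
  · simp [evq]
  · simp only [aeval_X]
    simp [evq]

theorem lift_sh0_monomial (q : ℂ) (hq : q.im ≠ 0) (b : ℕ) (c : ℂ) :
    Lift q (sh0 (Polynomial.monomial b c)) := by
  obtain ⟨α, β, h⟩ : ∃ α β : ℝ, c = α + β * q := by
    refine ⟨c.re - c.im / q.im * q.re, c.im / q.im, ?_⟩
    apply Complex.ext
    · simp
    · simp [hq]
  refine lift_of q _ (aeval ![X 0 + (C α + C β * X 2) * X 1 ^ b, X 1, X 2])
    (aeval ![X 0 - (C α + C β * X 2) * X 1 ^ b, X 1, X 2]) ?_ ?_ ?_ ?_ ?_ ?_ ?_ ?_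
  · simp
  · simp
  · simp [MvPolynomial.algebraMap_eq]
  · simp
  · simp [MvPolynomial.algebraMap_eq]
  · simp
  · simp only [aeval_X]
    simp only [evq, Matrix.cons_val_zero, map_add, map_mul, map_pow, aeval_X, aeval_C, sh0_X0,
      Polynomial.aeval_monomial, h, MvPolynomial.algebraMap_apply]
    simp [MvPolynomial.algebraMap_eq]
    ring
  · simp [evq]

theorem lift_sh0 (q : ℂ) (hq : q.im ≠ 0) (p : Polynomial ℂ) : Lift q (sh0 p) := by
  induction p using Polynomial.induction_on' with
  | add p p' h h' => rw [sh0_add]; exact h.comp h'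
  | monomial b c => exact lift_sh0_monomial q hq b c

theorem lift_sh1 (q : ℂ) (hq : q.im ≠ 0) (p : Polynomial ℂ) : Lift q (sh1 p) := by
  rw [sh1_eq]
  exact ((lift_sw q).comp (lift_sh0 q hq p)).comp (lift_sw q)

theorem lift_w (q : ℂ) (hq : q.im ≠ 0) (a : ℂ) (ha : a ≠ 0) :
    Lift q (aeval ![C a * X 1, - C a⁻¹ * X 0]) := by
  have h : (C a * C a⁻¹ : MvPolynomial (Fin 2) ℂ) = 1 := by rw [← C_mul, mul_inv_cancel₀ ha, C_1]
  have := ((lift_sh0 q hq (Polynomial.monomial 1 a)).comp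
    (lift_sh1 q hq (Polynomial.monomial 1 (-a⁻¹)))).comp (lift_sh0 q hq (Polynomial.monomial 1 a))
  convert this using 1
  apply hom_ext2
  · simp [hom_aeval, hom_C, MvPolynomial.algebraMap_eq]
    linear_combination (C a * X 1 + X 0) * h
  · simp [hom_aeval, hom_C, MvPolynomial.algebraMap_eq]
    linear_combination X 1 * h

theorem lift_dg (q : ℂ) (hq : q.im ≠ 0) (a : ℂ) (ha : a ≠ 0) : Lift q (dg a a⁻¹) := by
  have := (lift_w q hq a⁻¹ (inv_ne_zero ha)).comp (lift_w q hq (-1) (by simp))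
  convert this using 1
  apply hom_ext2 <;> simp [hom_C, MvPolynomial.algebraMap_eq]

theorem lift_tri (q : ℂ) (hq : q.im ≠ 0) (α β γ : ℂ) (p : Polynomial ℂ) (r : ℝ)
    (hr : α * γ = r) (h0 : α * γ ≠ 0)
    (φ : MvPolynomial (Fin 2) ℂ →ₐ[ℂ] MvPolynomial (Fin 2) ℂ)
    (hx : φ (X 0) = C α * X 0 + C β) (hy : φ (X 1) = C γ * X 1 + Polynomial.aeval (X 0) p) :
    Lift q φ := by
  have hα := left_ne_zero_of_mul h0
  have hγ := right_ne_zero_of_mul h0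
  have hr0 : r ≠ 0 := by rintro rfl; apply h0; simpa using hr
  have h := (((lift_sh1 q hq (Polynomial.C γ⁻¹ * p)).comp
    ((lift_dg q hq α hα).comp (lift_dg1 q r hr0)))).comp (lift_sh0 q hq (Polynomial.C β))
  convert h using 1
  have e1 : (C (γ : ℂ) : MvPolynomial (Fin 2) ℂ) = C (r:ℂ) * C α⁻¹ := by
    rw [← C_mul, ← hr]; congr 1; field_simp
  have e2 : (C γ * C γ⁻¹ : MvPolynomial (Fin 2) ℂ) = 1 := by rw [← C_mul, mul_inv_cancel₀ hγ, C_1]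
  apply hom_ext2
  · simp [hx, hom_C, MvPolynomial.algebraMap_eq]
  · simp only [hy, AlgHom.comp_apply, sh0_X1, dg_X1, map_mul, hom_C, sh1_X1, Polynomial.aeval_C,
      MvPolynomial.algebraMap_eq]
    rw [← mul_assoc, ← e1]
    linear_combination (- Polynomial.aeval (X 0) p) * e2

noncomputable def p0 : MvPolynomial (Fin 2) ℂ →ₐ[ℂ] Polynomial ℂ := aeval ![Polynomial.X, 0]
noncomputable def p1 : MvPolynomial (Fin 2) ℂ →ₐ[ℂ] Polynomial ℂ := aeval ![0, Polynomial.X]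

@[simp] theorem p0_X0 : p0 (X 0) = Polynomial.X := by simp [p0]
@[simp] theorem p0_X1 : p0 (X 1) = 0 := by simp [p0]
@[simp] theorem p1_X0 : p1 (X 0) = 0 := by simp [p1]
@[simp] theorem p1_X1 : p1 (X 1) = Polynomial.X := by simp [p1]

theorem eq_single0 (s : Fin 2 →₀ ℕ) (h : s 1 = 0) : s = Finsupp.single 0 (s 0) := by
  ext j; fin_cases j <;> simp [h]

theorem eq_single1 (s : Fin 2 →₀ ℕ) (h : s 0 = 0) : s = Finsupp.single 1 (s 1) := by
  ext j; fin_cases j <;> simp [h]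

theorem p0_coeff (F : MvPolynomial (Fin 2) ℂ) (k : ℕ) :
    (p0 F).coeff k = coeff (Finsupp.single 0 k) F := by
  induction F using MvPolynomial.induction_on' with
  | add p q hp hq => simp only [map_add, Polynomial.coeff_add, coeff_add, hp, hq]
  | monomial s a =>
    rw [p0, aeval_monomial, Finsupp.prod_fintype _ _ (by simp), coeff_monomial]
    simp only [Fin.prod_univ_two]
    by_cases h1 : s 1 = 0
    · rw [eq_single0 s h1]
      by_cases h2 : s 0 = k
      · simp [h2]
      · rw [if_neg]
        · simp [Polynomial.coeff_X_pow, Ne.symm h2]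
        · intro h; apply h2; simpa using DFunLike.congr_fun h 0
    · rw [if_neg]
      · simp [h1]
      · rintro rfl; simp at h1

theorem p1_coeff (F : MvPolynomial (Fin 2) ℂ) (k : ℕ) :
    (p1 F).coeff k = coeff (Finsupp.single 1 k) F := by
  induction F using MvPolynomial.induction_on' with
  | add p q hp hq => simp only [map_add, Polynomial.coeff_add, coeff_add, hp, hq]
  | monomial s a =>
    rw [p1, aeval_monomial, Finsupp.prod_fintype _ _ (by simp), coeff_monomial]
    simp only [Fin.prod_univ_two]
    by_cases h1 : s 0 = 0
    · rw [eq_single1 s h1]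
      by_cases h2 : s 1 = k
      · simp [h2]
      · rw [if_neg]
        · simp [Polynomial.coeff_X_pow, Ne.symm h2]
        · intro h; apply h2; simpa using DFunLike.congr_fun h 1
    · rw [if_neg]
      · simp [h1]
      · rintro rfl; simp at h1

theorem pd_ne (i : Fin 2) (F : MvPolynomial (Fin 2) ℂ) (s : Fin 2 →₀ ℕ) (hs : coeff s F ≠ 0)
    (h : s i ≠ 0) : pderiv i F ≠ 0 := by
  intro h0
  have h1 := coeff_pd i (s - Finsupp.single i 1) F
  have h2 : s - Finsupp.single i 1 + Finsupp.single i 1 = s := by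
    apply tsub_add_cancel_of_le
    simpa using Nat.one_le_iff_ne_zero.2 h
  rw [h0, h2] at h1
  have h3 : (((s - Finsupp.single i 1 : Fin 2 →₀ ℕ) i : ℂ) + 1) ≠ 0 := by
    exact Nat.cast_add_one_ne_zero _
  have := mul_ne_zero hs h3
  apply this
  rw [← h1]; simp

theorem top_weight (F : MvPolynomial (Fin 2) ℂ) (hL : IsLND (jd F)) (n m : ℕ)
    (hn : (p0 F).natDegree = n) (hm : (p1 F).natDegree = m) (s : Fin 2 →₀ ℕ)
    (hs : coeff s F ≠ 0) : wt m n s ≤ n * m := by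
  by_contra hlt
  obtain ⟨t, ht, hmax⟩ := Finset.exists_max_image F.support (wt m n) ⟨s, by simpa using hs⟩
  have hT := topPart_Top m n (wt m n t) F (fun s hs => hmax s (by simpa using hs))
  have hd : (n * m : ℤ) < wt m n t := lt_of_lt_of_le (not_le.1 hlt) (hmax s (by simpa using hs))
  have hpos0 : ∀ s, coeff s F ≠ 0 → wt m n s = wt m n t → s 0 ≠ 0 := by
    intro s hs hw h0
    rw [eq_single1 s h0, ← p1_coeff] at hs
    have h1 : s 1 ≤ m := hm ▸ Polynomial.le_natDegree_of_ne_zero hs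
    have : (n * s 1 : ℤ) ≤ n * m := by exact_mod_cast Nat.mul_le_mul_left n h1
    rw [← hw] at hd
    simp only [wt, h0] at hd
    push_cast at hd
    linarith
  have hpos1 : ∀ s, coeff s F ≠ 0 → wt m n s = wt m n t → s 1 ≠ 0 := by
    intro s hs hw h0
    rw [eq_single0 s h0, ← p0_coeff] at hs
    have h1 : s 0 ≤ n := hn ▸ Polynomial.le_natDegree_of_ne_zero hs
    have : (m * s 0 : ℤ) ≤ m * n := by exact_mod_cast Nat.mul_le_mul_left m h1
    rw [← hw] at hd
    simp only [wt, h0] at hd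
    push_cast at hd
    linarith
  have htF : coeff t F ≠ 0 := by simpa using ht
  have htt : coeff t (topPart m n (wt m n t) F) ≠ 0 := by
    rwa [coeff_topPart, if_pos rfl]
  have hdvd : X 1 ∣ topPart m n (wt m n t) F := by
    apply Finset.dvd_sum
    intro s hs
    simp only [Finset.mem_filter, mem_support_iff] at hs
    have := hpos1 s hs.1 hs.2
    rw [monomial_eq, Finsupp.prod_fintype _ _ (by simp), Fin.prod_univ_two]
    exact (dvd_pow_self _ this).mul_left _ |>.mul_left _
  have hne : topPart m n (wt m n t) F ≠ 0 := by
    intro h; rw [h] at htt; simp at htt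
  have h1 := lnd_ker_dvd (hT.isLND hL) (jd_self _) hne hdvd
  apply pd_ne 0 _ t htt (hpos0 t htF rfl)
  rw [jd_apply] at h1
  simpa [pderiv_X] using h1

theorem exists_root' (F : MvPolynomial (Fin 2) ℂ) (n m : ℕ)
    (hn : (p0 F).natDegree = n) (hn0 : n ≠ 0) :
    ∃ t : ℂ, ∑ s ∈ F.support with wt m n s = n * m, coeff s F * t ^ (s 0) = 0 := by
  have hc : coeff (Finsupp.single 0 n) F ≠ 0 := by
    rw [← p0_coeff, ← hn]
    intro h
    have : p0 F = 0 := Polynomial.leadingCoeff_eq_zero.1 h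
    rw [this] at hn; simp at hn; omega
  set R : Polynomial ℂ := ∑ s ∈ F.support with wt m n s = n * m,
    Polynomial.C (coeff s F) * Polynomial.X ^ (s 0) with hR
  have hcoef : R.coeff n = coeff (Finsupp.single 0 n) F := by
    rw [hR, Polynomial.finset_sum_coeff]
    rw [Finset.sum_eq_single (Finsupp.single 0 n)]
    · simp
    · intro s hs hne
      simp only [Finset.mem_filter, mem_support_iff] at hs
      rw [Polynomial.coeff_C_mul, Polynomial.coeff_X_pow, if_neg, mul_zero]
      intro h
      apply hne
      have h1 := hs.2
      simp only [wt] at h1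
      have h2 : (n : ℤ) * s 1 = 0 := by rw [← h] at h1; linarith
      have h3 : s 1 = 0 := by
        rcases mul_eq_zero.1 h2 with h4 | h4
        · omega
        · omega
      rw [eq_single0 s h3, ← h]
    · intro h
      exfalso; apply h
      simp only [Finset.mem_filter, mem_support_iff]
      refine ⟨hc, ?_⟩
      rw [wt_single0]; ring
  have hdeg : 0 < R.degree := by
    rw [← Polynomial.natDegree_pos_iff_degree_pos]
    have : n ≤ R.natDegree := Polynomial.le_natDegree_of_ne_zero (by rw [hcoef]; exact hc)
    omega
  obtain ⟨t, ht⟩ := Complex.exists_root hdeg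
  refine ⟨t, ?_⟩
  rw [Polynomial.IsRoot, hR, Polynomial.eval_finset_sum] at ht
  simpa using ht

theorem not_X_dvd (i j : Fin 2) (hij : i ≠ j) (k : ℕ) (c : ℂ) (hc : c ≠ 0)
    (p : MvPolynomial (Fin 2) ℂ) (h : X i ∣ C c * (X j ^ k * p)) : X i ∣ p := by
  have hu : IsUnit (C c : MvPolynomial (Fin 2) ℂ) := (isUnit_iff_ne_zero.2 hc).map C
  rw [hu.dvd_mul_left] at h
  rcases (MvPolynomial.X_prime (R := ℂ) (i := i)).dvd_or_dvd h with h | h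
  · have := (MvPolynomial.X_prime (R := ℂ) (i := i)).dvd_of_dvd_pow h
    rw [MvPolynomial.X_dvd_X] at this
    exact absurd this (by simpa using hij)
  · exact h

theorem divides (F : MvPolynomial (Fin 2) ℂ) (hL : IsLND (jd F)) (n m : ℕ)
    (hn : (p0 F).natDegree = n) (hm : (p1 F).natDegree = m) (hn0 : n ≠ 0) (hm0 : m ≠ 0) :
    n ∣ m ∨ m ∣ n := by
  have hw := top_weight F hL n m hn hm
  have hT := topPart_Top m n (n * m) F hw
  have hL' := hT.isLND hL
  obtain ⟨t, ht⟩ := exists_root' F n m hn hn0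
  set F' := topPart m n (n * m) F with hF'
  have hc0 : coeff (Finsupp.single 0 n) F' ≠ 0 := by
    rw [hF', coeff_topPart, if_pos (by rw [wt_single0]; ring), ← p0_coeff, ← hn]
    intro h
    have : p0 F = 0 := Polynomial.leadingCoeff_eq_zero.1 h
    rw [this] at hn; simp at hn; omega
  have hc1 : coeff (Finsupp.single 1 m) F' ≠ 0 := by
    rw [hF', coeff_topPart, if_pos (by rw [wt_single1]), ← p1_coeff, ← hm]
    intro h
    have : p1 F = 0 := Polynomial.leadingCoeff_eq_zero.1 h
    rw [this] at hm; simp at hm; omega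
  have hd0 : pderiv 0 F' ≠ 0 := pd_ne 0 F' _ hc0 (by simpa using hn0)
  have hd1 : pderiv 1 F' ≠ 0 := pd_ne 1 F' _ hc1 (by simpa using hm0)
  have hF0 : F' ≠ 0 := by intro h; rw [h] at hd0; simp at hd0
  have hDX0 : jd F' (X 0) ≠ 0 := by rw [jd_apply]; simpa [pderiv_X] using hd1
  have hDX1 : jd F' (X 1) ≠ 0 := by rw [jd_apply]; simpa [pderiv_X] using hd0
  obtain ⟨g, a, b, hg, hco, ha, hb⟩ := Nat.exists_coprime' (m := n) (n := m)
    (Nat.gcd_pos_of_pos_left _ (Nat.pos_of_ne_zero hn0))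
  by_cases ha1 : a = 1
  · left; rw [ha, hb, ha1]; simp
  by_cases hb1 : b = 1
  · right; rw [ha, hb, hb1]; simp
  exfalso
  have ha0 : a ≠ 0 := by rintro rfl; simp at ha; omega
  have hb0 : b ≠ 0 := by rintro rfl; simp at hb; omega
  have hdvd : (X 0 ^ a - C (t ^ a) * X 1 ^ b) ∣ F' := by
    have e : F' = ∑ s ∈ F.support with wt m n s = n * m,
        (C (coeff s F) * (X 0 ^ (s 0) * X 1 ^ (s 1) - C (t ^ (s 0)) * X 1 ^ m)) := by
      have e1 : ∑ s ∈ F.support with wt m n s = n * m,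
        (C (coeff s F) * (C (t ^ (s 0)) * X 1 ^ m)) = (0 : MvPolynomial (Fin 2) ℂ) := by
        have : ∀ s : Fin 2 →₀ ℕ, C (coeff s F) * (C (t ^ (s 0)) * X 1 ^ m) =
            C (coeff s F * t ^ (s 0)) * (X 1 ^ m : MvPolynomial (Fin 2) ℂ) := by
          intro s; rw [C_mul]; ring
        simp only [this]
        rw [← Finset.sum_mul, ← map_sum, ht]; simp
      simp only [mul_sub]
      rw [Finset.sum_sub_distrib, e1, sub_zero, hF', topPart]
      refine Finset.sum_congr rfl fun s _ => ?_
      rw [monomial_eq, Finsupp.prod_fintype _ _ (by simp), Fin.prod_univ_two]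
    rw [e]
    apply Finset.dvd_sum
    intro s hs
    apply Dvd.dvd.mul_left
    have hs := (Finset.mem_filter.1 hs).2
    simp only [wt] at hs
    have h1 : m * s 0 + n * s 1 = n * m := by exact_mod_cast hs
    have h2 : b * s 0 + a * s 1 = a * (g * b) := by
      apply Nat.eq_of_mul_eq_mul_left hg
      rw [ha, hb] at h1
      linarith
    have h3 : a ∣ b * s 0 := by
      rw [← Nat.dvd_add_left (Dvd.intro _ rfl : a ∣ a * s 1), h2]
      exact Dvd.intro _ rfl
    obtain ⟨k, hk⟩ := hco.dvd_of_dvd_mul_left h3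
    have h4 : b * k + s 1 = m := by
      apply Nat.eq_of_mul_eq_mul_left (Nat.pos_of_ne_zero ha0)
      rw [hk] at h2
      rw [hb]
      linarith
    have h5 : (X 0 ^ (s 0) * X 1 ^ (s 1) - C (t ^ (s 0)) * X 1 ^ m : MvPolynomial (Fin 2) ℂ)
      = ((X 0 ^ a) ^ k - (C (t ^ a) * X 1 ^ b) ^ k) * X 1 ^ (s 1) := by
      rw [hk, ← h4, C_pow, C_pow]; ring
    rw [h5]
    exact (sub_dvd_pow_sub_pow _ _ _).mul_right _
  have hker := lnd_ker_dvd hL' (jd_self _) hF0 hdvd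
  have hrel : C (a : ℂ) * (X 0 ^ (a - 1) * jd F' (X 0)) =
      C (t ^ a * b) * (X 1 ^ (b - 1) * jd F' (X 1)) := by
    have hCC : jd F' (C (t ^ a)) = 0 := by
      rw [← MvPolynomial.algebraMap_eq]; exact Derivation.map_algebraMap _ _
    rw [map_sub, Derivation.leibniz, Derivation.leibniz_pow, Derivation.leibniz_pow, hCC] at hker
    simp only [nsmul_eq_mul, smul_eq_mul] at hker
    have e1 : (C (a : ℂ) : MvPolynomial (Fin 2) ℂ) = (a : MvPolynomial (Fin 2) ℂ) := by simp
    have e2 : (C (b : ℂ) : MvPolynomial (Fin 2) ℂ) = (b : MvPolynomial (Fin 2) ℂ) := by simp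
    rw [C_mul, e1, e2]
    linear_combination hker
  have haC : (a : ℂ) ≠ 0 := by exact_mod_cast ha0
  have hbC : (b : ℂ) ≠ 0 := by exact_mod_cast hb0
  have ht0 : t ≠ 0 := by
    rintro rfl
    rw [zero_pow ha0, zero_mul, C_0, zero_mul] at hrel
    rcases mul_eq_zero.1 hrel with h | h
    · rw [MvPolynomial.C_eq_zero] at h; exact haC h
    · rcases mul_eq_zero.1 h with h | h
      · exact pow_ne_zero _ (MvPolynomial.X_ne_zero _) h
      · exact hDX0 h
  have hx1 : X 1 ∣ jd F' (X 0) := by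
    apply not_X_dvd 1 0 (by simp) (a - 1) a haC
    rw [hrel]
    exact ((dvd_pow_self _ (by omega)).mul_right _).mul_left _
  have hx0 : X 0 ∣ jd F' (X 1) := by
    apply not_X_dvd 0 1 (by simp) (b - 1) (t ^ a * b) (mul_ne_zero (pow_ne_zero _ ht0) hbC)
    rw [← hrel]
    exact ((dvd_pow_self _ (by omega)).mul_right _).mul_left _
  rcases lnd_cross hL' (MvPolynomial.X_ne_zero _) (MvPolynomial.X_ne_zero _) hx1 hx0 with h | h
  · exact hDX0 h
  · exact hDX1 h

theorem step_deg (F : MvPolynomial (Fin 2) ℂ) (hL : IsLND (jd F)) (n m b : ℕ)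
    (hn : (p0 F).natDegree = n) (hm : (p1 F).natDegree = m) (hn0 : n ≠ 0) (hm0 : m ≠ 0)
    (hb : m = n * b) :
    ∃ t : ℂ, (p1 (sh0 (Polynomial.monomial b t) F)).natDegree < m ∧
      (p0 (sh0 (Polynomial.monomial b t) F)).natDegree = n := by
  have hw := top_weight F hL n m hn hm
  obtain ⟨t, ht⟩ := exists_root' F n m hn hn0
  have hb0 : b ≠ 0 := by rintro rfl; simp at hb; omega
  refine ⟨t, ?_, ?_⟩
  · have e : p1 (sh0 (Polynomial.monomial b t) F) =
        ∑ s ∈ F.support, Polynomial.monomial (b * s 0 + s 1) (coeff s F * t ^ (s 0)) := by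
      have e1 : p1.comp (sh0 (Polynomial.monomial b t)) =
          aeval ![Polynomial.C t * Polynomial.X ^ b, Polynomial.X] := by
        apply hom_ext2
        · simp [hom_aeval, Polynomial.aeval_monomial]
        · simp
      have e2 := DFunLike.congr_fun e1 F
      rw [AlgHom.comp_apply] at e2
      rw [e2, aeval_def, eval₂_eq']
      refine Finset.sum_congr rfl fun s _ => ?_
      rw [Fin.prod_univ_two, ← Polynomial.C_mul_X_pow_eq_monomial]
      simp
      ring
    have hle : ∀ s ∈ F.support, b * s 0 + s 1 ≤ m := by
      intro s hs
      have h1 := hw s (by simpa using hs)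
      simp only [wt] at h1
      have h2 : m * s 0 + n * s 1 ≤ n * m := by exact_mod_cast h1
      apply Nat.le_of_mul_le_mul_left _ (Nat.pos_of_ne_zero hn0)
      rw [hb] at h2 ⊢
      linarith
    have hdeg : (p1 (sh0 (Polynomial.monomial b t) F)).natDegree ≤ m := by
      rw [e]
      apply Polynomial.natDegree_sum_le_of_forall_le
      intro s hs
      exact (Polynomial.natDegree_monomial_le _).trans (hle s hs)
    have hcoef : (p1 (sh0 (Polynomial.monomial b t) F)).coeff m = 0 := by
      rw [e, Polynomial.finset_sum_coeff, ← ht, Finset.sum_filter]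
      refine Finset.sum_congr rfl fun s _ => ?_
      rw [Polynomial.coeff_monomial]
      have : b * s 0 + s 1 = m ↔ wt m n s = n * m := by
        simp only [wt]
        have : (m * s 0 + n * s 1 : ℤ) = n * m ↔ m * s 0 + n * s 1 = n * m := by
          exact_mod_cast Iff.rfl
        rw [this]
        constructor
        · intro h
          calc m * s 0 + n * s 1 = n * (b * s 0 + s 1) := by rw [hb]; ring
            _ = n * m := by rw [h]
        · intro h
          apply Nat.eq_of_mul_eq_mul_left (Nat.pos_of_ne_zero hn0)
          rw [← h, hb]; ring
      simp only [this]
    apply lt_of_le_of_ne hdeg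
    intro h
    rw [← h] at hcoef
    have h0 : p1 (sh0 (Polynomial.monomial b t) F) = 0 := Polynomial.leadingCoeff_eq_zero.1 hcoef
    rw [h0] at h; simp at h; omega
  · have e1 : p0.comp (sh0 (Polynomial.monomial b t)) = p0 := by
      apply hom_ext2
      · simp [hom_aeval, Polynomial.aeval_monomial, hb0]
      · simp
    have e2 := DFunLike.congr_fun e1 F
    rw [AlgHom.comp_apply] at e2
    rw [e2, hn]

theorem eq_C_of_pd (K : MvPolynomial (Fin 2) ℂ) (h0 : pderiv 0 K = 0) (h1 : pderiv 1 K = 0) :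
    K = C (coeff 0 K) := by
  ext s
  rw [coeff_C]
  split_ifs with h
  · rw [h]
  · by_contra hs
    by_cases hs0 : s 0 = 0
    · by_cases hs1 : s 1 = 0
      · apply h
        rw [eq_single0 s hs1, hs0]; simp
      · exact pd_ne 1 K s hs hs1 h1
    · exact pd_ne 0 K s hs hs0 h0

theorem eq_of_pd1 (H : MvPolynomial (Fin 2) ℂ) (h1 : pderiv 1 H = 0) :
    H = Polynomial.aeval (X 0) (p0 H) := by
  rw [← sub_eq_zero]
  have hd : pderiv 1 (H - Polynomial.aeval (X 0) (p0 H)) = 0 := by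
    rw [map_sub, h1, Derivation.map_aeval]
    simp [pderiv_X]
  have hp : p0 (H - Polynomial.aeval (X 0) (p0 H)) = 0 := by
    rw [map_sub, hom_aeval, p0_X0, Polynomial.aeval_X_left_apply, sub_self]
  ext s
  rw [coeff_zero]
  by_contra hs
  by_cases hs1 : s 1 = 0
  · rw [eq_single0 s hs1, ← p0_coeff, hp] at hs
    simp at hs
  · exact pd_ne 1 _ s hs hs1 hd

theorem X0_dvd (F : MvPolynomial (Fin 2) ℂ) : X 0 ∣ F - Polynomial.aeval (X 1) (p1 F) := by
  rw [← Ideal.mem_span_singleton, ← Ideal.Quotient.eq]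
  have : (Ideal.Quotient.mkₐ ℂ (Ideal.span {(X 0 : MvPolynomial (Fin 2) ℂ)})) =
    ((Ideal.Quotient.mkₐ ℂ (Ideal.span {(X 0 : MvPolynomial (Fin 2) ℂ)})).comp
      (Polynomial.aeval (X 1 : MvPolynomial (Fin 2) ℂ))).comp p1 := by
    apply hom_ext2
    · simp [Ideal.Quotient.eq_zero_iff_mem, Ideal.mem_span_singleton]
    · simp
  exact DFunLike.congr_fun this F

theorem base (q : ℂ) (hq : q.im ≠ 0) (φ : MvPolynomial (Fin 2) ℂ →ₐ[ℂ] MvPolynomial (Fin 2) ℂ)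
    (hs : Function.Surjective φ) (r : ℝ) (hr : Jac φ = C (r : ℂ))
    (h : (p1 (φ (X 0))).natDegree = 0) : Lift q φ := by
  have hL := jd_isLND φ hs r hr
  have hJ := Jac_isUnit φ hs
  have hd : pderiv 1 (φ (X 0)) = 0 := by
    obtain ⟨c, hc⟩ := Polynomial.natDegree_eq_zero.1 h
    have h1 := X0_dvd (φ (X 0))
    rw [← hc, Polynomial.aeval_C] at h1
    by_cases h0 : φ (X 0) - algebraMap ℂ _ c = 0
    · rw [sub_eq_zero] at h0
      rw [h0]; simp
    · have h2 := lnd_ker_dvd hL (by rw [map_sub, jd_self, Derivation.map_algebraMap, sub_zero])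
        h0 h1
      rw [jd_apply] at h2
      simpa [pderiv_X] using h2
  have hJ2 := hr
  rw [Jac, hd, zero_mul, sub_zero] at hJ2
  rw [hr, ← hJ2] at hJ
  obtain ⟨α, hα, hα'⟩ := MvPolynomial.isUnit_iff_eq_C_of_isReduced.1 (isUnit_of_mul_isUnit_left hJ)
  obtain ⟨γ, hγ, hγ'⟩ := MvPolynomial.isUnit_iff_eq_C_of_isReduced.1 (isUnit_of_mul_isUnit_right hJ)
  rw [hα', hγ', ← C_mul] at hJ2
  have hag := MvPolynomial.C_injective _ _ hJ2
  have e0 := eq_C_of_pd (φ (X 0) - C α * X 0) (by simp [hα', pderiv_X]) (by simp [hd, pderiv_X])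
  have e1 := eq_of_pd1 (φ (X 1) - C γ * X 1) (by simp [hγ', pderiv_X])
  refine lift_tri q hq α (coeff 0 (φ (X 0) - C α * X 0)) γ (p0 (φ (X 1) - C γ * X 1)) r hag
    (mul_ne_zero hα.ne_zero hγ.ne_zero) φ ?_ ?_
  · rw [← e0]; ring
  · rw [← e1]; ring

theorem Jac_sw : Jac sw = C ((-1 : ℝ) : ℂ) := by simp [Jac, pderiv_X]

theorem Jac_sh0 (p : Polynomial ℂ) : Jac (sh0 p) = 1 := by
  simp [Jac, pderiv_X, Derivation.map_aeval]

theorem p1_sw (F : MvPolynomial (Fin 2) ℂ) : p1 (sw F) = p0 F := by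
  have : p1.comp sw = p0 := hom_ext2 (by simp) (by simp)
  exact DFunLike.congr_fun this F

theorem p0_sw (F : MvPolynomial (Fin 2) ℂ) : p0 (sw F) = p1 F := by
  have : p0.comp sw = p1 := hom_ext2 (by simp) (by simp)
  exact DFunLike.congr_fun this F

theorem surj_of_inv {τ τ' : MvPolynomial (Fin 2) ℂ →ₐ[ℂ] MvPolynomial (Fin 2) ℂ}
    (h : τ.comp τ' = AlgHom.id ℂ _) : Function.Surjective τ :=
  fun x => ⟨τ' x, DFunLike.congr_fun h x⟩

theorem main_lift (q : ℂ) (hq : q.im ≠ 0) : ∀ (N : ℕ)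
    (φ : MvPolynomial (Fin 2) ℂ →ₐ[ℂ] MvPolynomial (Fin 2) ℂ), Function.Surjective φ →
    ∀ r : ℝ, Jac φ = C (r : ℂ) →
    (p0 (φ (X 0))).natDegree + (p1 (φ (X 0))).natDegree = N → Lift q φ := by
  intro N
  induction N using Nat.strong_induction_on with
  | _ N ih =>
    -- the case where the first degree divides the second
    have key : ∀ (φ : MvPolynomial (Fin 2) ℂ →ₐ[ℂ] MvPolynomial (Fin 2) ℂ),
        Function.Surjective φ → ∀ r : ℝ, Jac φ = C (r : ℂ) →
        (p0 (φ (X 0))).natDegree + (p1 (φ (X 0))).natDegree = N →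
        (p0 (φ (X 0))).natDegree ∣ (p1 (φ (X 0))).natDegree → Lift q φ := by
      intro φ hs r hr hN hdvd
      by_cases hm : (p1 (φ (X 0))).natDegree = 0
      · exact base q hq φ hs r hr hm
      obtain ⟨b, hb⟩ := hdvd
      have hn : (p0 (φ (X 0))).natDegree ≠ 0 := by
        intro h; rw [h, zero_mul] at hb; exact hm hb
      obtain ⟨t, ht1, ht0⟩ := step_deg (φ (X 0)) (jd_isLND φ hs r hr)
        (p0 (φ (X 0))).natDegree (p1 (φ (X 0))).natDegree b rfl rfl hn hm hb
      have hl : Lift q ((sh0 (Polynomial.monomial b t)).comp φ) := by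
        refine ih _ ?_ _ (by rw [AlgHom.coe_comp]; exact (surj_of_inv (sh0_neg' _)).comp hs) r ?_ rfl
        · simp only [AlgHom.comp_apply]
          omega
        · rw [Jac_comp, Jac_sh0, hr, hom_C, mul_one]
      have := (lift_sh0 q hq (-Polynomial.monomial b t)).comp hl
      rwa [← AlgHom.comp_assoc, sh0_neg, AlgHom.id_comp] at this
    have key2 : ∀ (φ : MvPolynomial (Fin 2) ℂ →ₐ[ℂ] MvPolynomial (Fin 2) ℂ),
        Function.Surjective φ → ∀ r : ℝ, Jac φ = C (r : ℂ) →
        (p0 (φ (X 0))).natDegree + (p1 (φ (X 0))).natDegree = N →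
        (p1 (φ (X 0))).natDegree ∣ (p0 (φ (X 0))).natDegree → Lift q φ := by
      intro φ hs r hr hN hdvd
      have hl : Lift q (sw.comp φ) := by
        refine key _ (by rw [AlgHom.coe_comp]; exact (surj_of_inv sw_sw).comp hs) (-r) ?_ ?_ ?_
        · rw [Jac_comp, Jac_sw, hr, hom_C, ← C_mul]; congr 1; push_cast; ring
        · simp only [AlgHom.comp_apply, p0_sw, p1_sw]; omega
        · simpa only [AlgHom.comp_apply, p0_sw, p1_sw] using hdvd
      have := (lift_sw q).comp hl
      rwa [← AlgHom.comp_assoc, sw_sw, AlgHom.id_comp] at this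
    intro φ hs r hr hN
    by_cases hm : (p1 (φ (X 0))).natDegree = 0
    · exact key φ hs r hr hN (by simp [hm])
    by_cases hn : (p0 (φ (X 0))).natDegree = 0
    · exact key2 φ hs r hr hN (by simp [hn])
    rcases divides (φ (X 0)) (jd_isLND φ hs r hr)
      (p0 (φ (X 0))).natDegree (p1 (φ (X 0))).natDegree rfl rfl hn hm with h | h
    · exact key φ hs r hr hN h
    · exact key2 φ hs r hr hN h

/-- For `q ∈ ℂ ∖ ℝ`, `Ψ_q` maps `{f ∈ Aut_ℝ(ℝ[x,y,z]) : f(z) = z}` into `Aut_ℂ(ℂ[x,y])`,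
is a group homomorphism, and its image consists exactly of the automorphisms of
`ℂ[x,y]` with real Jacobian determinant. -/
theorem Psi_hom_and_image (q : ℂ) (hq : q.im ≠ 0) :
    (∀ f : MvPolynomial (Fin 3) ℝ ≃ₐ[ℝ] MvPolynomial (Fin 3) ℝ, f (X 2) = X 2 →
      Function.Bijective (Psi q f.toAlgHom)) ∧
    (Psi q (AlgHom.id ℝ (MvPolynomial (Fin 3) ℝ)) = AlgHom.id ℂ (MvPolynomial (Fin 2) ℂ)) ∧
    (∀ f g : MvPolynomial (Fin 3) ℝ ≃ₐ[ℝ] MvPolynomial (Fin 3) ℝ,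
      f (X 2) = X 2 → g (X 2) = X 2 →
      Psi q (f.toAlgHom.comp g.toAlgHom) = (Psi q f.toAlgHom).comp (Psi q g.toAlgHom)) ∧
    (∀ φ : MvPolynomial (Fin 2) ℂ →ₐ[ℂ] MvPolynomial (Fin 2) ℂ, Function.Bijective φ →
      ((∃ f : MvPolynomial (Fin 3) ℝ ≃ₐ[ℝ] MvPolynomial (Fin 3) ℝ,
          f (X 2) = X 2 ∧ Psi q f.toAlgHom = φ) ↔
        ∃ r : ℝ, Jac φ = MvPolynomial.C (r : ℂ))) := by
  refine ⟨fun f hf => Psi_bij q f hf, Psi_id q, fun f g hf _ => Psi_comp q _ _ hf, fun φ hφ => ⟨?_, ?_⟩⟩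
  · rintro ⟨f, hf, rfl⟩
    exact Psi_jac q f hf
  · rintro ⟨r, hr⟩
    exact main_lift q hq _ φ hφ.2 r hr rfl
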